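/- Let T be a tree with no degree-2 vertices and at least 3 leaves. Then there exists a family of h₁(T) paths in T that simultaneously separates and covers E(T), and separates and covers V(T) ∪ E*(T), where h₁(T) is the number of leaves and E*(T) the set of interior edges. -/

import Mathlib

open SimpleGraph
open scoped Classical

universe u

variable {V : Type u}

/-- A path in a graph `G`, recorded with its two endpoints. -/
def PathIn {V : Type u} (G : SimpleGraph V) : Type u :=
  Σ a b : V, {p : G.Walk a b // p.IsPath}

/-- The path `P` contains the vertex `x`. -/
def PathIn.vmem {G : SimpleGraph V} (x : V) (P : PathIn G) : Prop :=
  x ∈ P.2.2.1.support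

/-- The path `P` contains the edge `e`. -/
def PathIn.emem {G : SimpleGraph V} (e : Sym2 V) (P : PathIn G) : Prop :=
  e ∈ P.2.2.1.edges

/-- The path `P` contains the element `s` (a vertex or an edge). -/
def ElemMem (G : SimpleGraph V) (s : V ⊕ Sym2 V) (P : PathIn G) : Prop :=
  Sum.elim (fun x => PathIn.vmem x P) (fun e => PathIn.emem e P) s

/-- `F` separates the set `S` of elements (vertices and/or edges) of `G`. -/
def Separates (G : SimpleGraph V) (S : Set (V ⊕ Sym2 V)) (F : Set (PathIn G)) : Prop :=
  ∀ s ∈ S, ∀ t ∈ S, s ≠ t → ∃ P ∈ F,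
    (ElemMem G s P ∧ ¬ ElemMem G t P) ∨ (¬ ElemMem G s P ∧ ElemMem G t P)

/-- `F` covers the set `S` of elements of `G`. -/
def Covers (G : SimpleGraph V) (S : Set (V ⊕ Sym2 V)) (F : Set (PathIn G)) : Prop :=
  ∀ s ∈ S, ∃ P ∈ F, ElemMem G s P

/-- `F` separates the edges of `G`. -/
def EdgeSep (G : SimpleGraph V) (F : Set (PathIn G)) : Prop :=
  ∀ e ∈ G.edgeSet, ∀ f ∈ G.edgeSet, e ≠ f → ∃ P ∈ F,
    (PathIn.emem e P ∧ ¬ PathIn.emem f P) ∨ (¬ PathIn.emem e P ∧ PathIn.emem f P)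

/-- `F` covers the edges of `G`. -/
def EdgeCover (G : SimpleGraph V) (F : Set (PathIn G)) : Prop :=
  ∀ e ∈ G.edgeSet, ∃ P ∈ F, PathIn.emem e P

/-- `F` separates the vertices of `G`. -/
def VertexSep (G : SimpleGraph V) (F : Set (PathIn G)) : Prop :=
  ∀ x y : V, x ≠ y → ∃ P ∈ F,
    (PathIn.vmem x P ∧ ¬ PathIn.vmem y P) ∨ (¬ PathIn.vmem x P ∧ PathIn.vmem y P)

/-- `F` covers the vertices of `G`. -/
def VertexCover (G : SimpleGraph V) (F : Set (PathIn G)) : Prop :=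
  ∀ x : V, ∃ P ∈ F, PathIn.vmem x P

/-- The number of leaves of `G`. -/
noncomputable def leafCount (G : SimpleGraph V) [Fintype V] : ℕ :=
  Nat.card {x : V | G.degree x = 1}

/-- The number of degree-two vertices of `G`. -/
noncomputable def deg2Count (G : SimpleGraph V) [Fintype V] : ℕ :=
  Nat.card {x : V | G.degree x = 2}

/-- The set of interior edges: edges with neither endpoint a leaf. -/
noncomputable def interiorEdgeSet (G : SimpleGraph V) [Fintype V] : Set (Sym2 V) :=
  {e : Sym2 V | e ∈ G.edgeSet ∧ ∀ x ∈ e, G.degree x ≠ 1}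

section Helpers

noncomputable def pth {G : SimpleGraph V} (hT : G.IsTree) (a b : V) : G.Walk a b :=
  (hT.existsUnique_path a b).choose

theorem pth_isPath {G : SimpleGraph V} (hT : G.IsTree) (a b : V) : (pth hT a b).IsPath :=
  (hT.existsUnique_path a b).choose_spec.1

theorem pth_uniq {G : SimpleGraph V} (hT : G.IsTree) {a b : V} {p : G.Walk a b}
    (hp : p.IsPath) : p = pth hT a b :=
  (hT.existsUnique_path a b).unique hp (pth_isPath hT a b)

def RR (G : SimpleGraph V) (e : Sym2 V) (a b : V) : Prop := (G.deleteEdges {e}).Reachable a b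

/-- The path from `a` to `b` avoids `e` iff they are connected after deleting `e`. -/
theorem on_iff {G : SimpleGraph V} (hT : G.IsTree) (e : Sym2 V) (a b : V) :
    e ∈ (pth hT a b).edges ↔ ¬ RR G e a b := by
  constructor
  · rintro he ⟨w⟩
    have hw := pth_uniq hT (p := (w.toPath.1.mapLe (G.deleteEdges_le {e})))
      (Walk.IsPath.mapLe _ w.toPath.2)
    rw [← hw, Walk.edges_mapLe_eq_edges] at he
    have := Walk.edges_subset_edgeSet _ he
    simp [edgeSet_deleteEdges] at this
  · intro h
    by_contra he
    exact h ⟨(pth hT a b).toDeleteEdge e he⟩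

theorem RR.symm {G : SimpleGraph V} {e : Sym2 V} {a b : V} (h : RR G e a b) : RR G e b a :=
  Reachable.symm h
theorem RR.trans {G : SimpleGraph V} {e : Sym2 V} {a b c : V} (h : RR G e a b) (h' : RR G e b c) :
    RR G e a c := Reachable.trans h h'
theorem RR.refl {G : SimpleGraph V} (e : Sym2 V) (a : V) : RR G e a a := Reachable.refl a

theorem RR_two {G : SimpleGraph V} (hT : G.IsTree) {x y : V} (hxy : G.Adj x y) (a : V) :
    RR G s(x, y) a x ∨ RR G s(x, y) a y := by
  by_cases h : s(x, y) ∈ (pth hT a x).edges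
  · right
    have hy := Walk.snd_mem_support_of_mem_edges _ h
    refine ⟨((pth hT a x).takeUntil y hy).toDeleteEdge _ ?_⟩
    intro h'
    have := Walk.fst_mem_support_of_mem_edges _ h'
    exact Walk.endpoint_notMem_support_takeUntil (pth_isPath hT a x) hy hxy.ne this
  · left
    by_contra h'
    exact h ((on_iff hT _ _ _).2 h')

theorem RR_adj {G : SimpleGraph V} (hT : G.IsTree) {x y : V} (hxy : G.Adj x y) :
    ¬ RR G s(x, y) x y := by
  rw [← on_iff hT]
  rw [← pth_uniq hT (p := Walk.cons hxy Walk.nil) (by simp [hxy.ne])]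
  simp

theorem RR_xor {G : SimpleGraph V} (hT : G.IsTree) {e : Sym2 V} (he : e ∈ G.edgeSet) (r a b : V) :
    RR G e a b ↔ (RR G e r a ↔ RR G e r b) := by
  induction e with | _ x y =>
  have hxy : G.Adj x y := he
  have h1 := RR_two hT hxy r
  have h2 := RR_two hT hxy a
  have h3 := RR_two hT hxy b
  constructor
  · intro h
    exact ⟨fun h' => h'.trans h, fun h' => h'.trans h.symm⟩
  · intro h
    by_cases hr : RR G s(x, y) r a
    · exact hr.symm.trans (h.1 hr)
    · have hrb : ¬ RR G s(x, y) r b := fun h' => hr (h.2 h')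
      rcases h1 with h1 | h1 <;> rcases h2 with h2 | h2 <;> rcases h3 with h3 | h3 <;>
        first
        | exact h2.trans h3.symm
        | exact absurd (h1.trans h2.symm) hr
        | exact absurd (h1.trans h3.symm) hrb

/-- Orientation of an edge relative to a root. -/
theorem orient {G : SimpleGraph V} (hT : G.IsTree) {e : Sym2 V} (he : e ∈ G.edgeSet) (r : V) :
    ∃ y ∈ e, ∀ a, e ∈ (pth hT r a).edges ↔ y ∈ (pth hT r a).support := by
  have key : ∀ x y : V, G.Adj x y → y ∉ (pth hT r x).support →
      ∀ a, s(x, y) ∈ (pth hT r a).edges ↔ y ∈ (pth hT r a).support := by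
    intro x y hxy hy a
    refine ⟨Walk.snd_mem_support_of_mem_edges _, fun h => ?_⟩
    have h1 := pth_uniq hT ((pth_isPath hT r x).concat hy hxy)
    have h2 := pth_uniq hT ((pth_isPath hT r a).takeUntil h)
    apply Walk.edges_takeUntil_subset_edges _ h
    rw [h2, ← h1]
    simp [Walk.edges_concat]
  induction e with | _ x y =>
  have hxy : G.Adj x y := he
  by_cases hy : y ∈ (pth hT r x).support
  · refine ⟨x, by simp, ?_⟩
    rw [Sym2.eq_swap]
    apply key y x hxy.symm
    rw [← pth_uniq hT ((pth_isPath hT r x).takeUntil hy)]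
    exact Walk.endpoint_notMem_support_takeUntil (pth_isPath hT r x) hy hxy.ne
  · exact ⟨y, by simp, key x y hxy hy⟩

theorem first_edge {G : SimpleGraph V} {u a s t : V} {p : G.Walk u a} (hp : p.IsPath)
    (hs : s(u, s) ∈ p.edges) (ht : s(u, t) ∈ p.edges) : s = t := by
  cases p with
  | nil => simp at hs
  | @cons _ v _ h p =>
    rw [Walk.cons_isPath_iff] at hp
    have key : ∀ z, s(u, z) ∈ (Walk.cons h p).edges → z = v := by
      intro z hz
      rw [Walk.edges_cons, List.mem_cons] at hz
      rcases hz with hz | hz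
      · exact Sym2.congr_right.1 hz
      · exact absurd (Walk.fst_mem_support_of_mem_edges _ hz) hp.2
    rw [key s hs, key t ht]

theorem subpath_edge {G : SimpleGraph V} (hT : G.IsTree) {u v : V} {a b : V} {p : G.Walk a b}
    (hp : p.IsPath) (hu : u ∈ p.support) (hv : v ∈ p.support) {e : Sym2 V}
    (he : e ∈ (pth hT u v).edges) : e ∈ p.edges := by
  have hsym : (pth hT v u).reverse = pth hT u v := pth_uniq hT (pth_isPath hT v u).reverse
  have hv' := hv
  rw [← p.take_spec hu, Walk.mem_support_append_iff] at hv'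
  rcases hv' with h | h
  · have h1 := pth_uniq hT ((hp.takeUntil hu).dropUntil h)
    apply Walk.edges_takeUntil_subset_edges _ hu
    apply Walk.edges_dropUntil_subset_edges _ h
    rw [h1]
    rw [← hsym] at he
    simpa using he
  · have h1 := pth_uniq hT ((hp.dropUntil hu).takeUntil h)
    apply Walk.edges_dropUntil_subset_edges _ hu
    apply Walk.edges_takeUntil_subset_edges _ h
    rw [h1]
    exact he

/-- Each branch contains a leaf. -/
theorem exists_leaf [Fintype V] {G : SimpleGraph V} (hT : G.IsTree) {u w : V} (h : G.Adj u w) :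
    ∃ a, G.degree a = 1 ∧ s(u, w) ∈ (pth hT u a).edges := by
  have hne : (Finset.univ.filter (fun a => s(u, w) ∈ (pth hT u a).edges)).Nonempty :=
    ⟨w, by
      simp only [Finset.mem_filter, Finset.mem_univ, true_and]
      rw [on_iff hT]; exact RR_adj hT h⟩
  obtain ⟨a, ha, hmax⟩ := Finset.exists_max_image _ (fun a => (pth hT u a).length) hne
  simp only [Finset.mem_filter, Finset.mem_univ, true_and] at ha hmax
  refine ⟨a, ?_, ha⟩
  have hnil : ¬ (pth hT u a).Nil := by
    intro hn
    rw [Walk.nil_iff_support_eq] at hn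
    have h1 := Walk.snd_mem_support_of_mem_edges _ ha
    rw [hn] at h1
    simp at h1
    exact h.ne h1.symm
  rw [← card_neighborFinset_eq_degree, Finset.card_eq_one]
  refine ⟨(pth hT u a).penultimate, ?_⟩
  ext b
  simp only [mem_neighborFinset, Finset.mem_singleton]
  constructor
  · intro hb
    by_cases hbs : b ∈ (pth hT u a).support
    · have hab : s(b, a) ∈ (pth hT u a).edges := by
        apply subpath_edge hT (pth_isPath hT u a) hbs (Walk.end_mem_support _)
        rw [on_iff hT]
        exact RR_adj hT hb.symm
      have hab' : s(a, b) ∈ (pth hT u a).reverse.edges := by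
        rw [Walk.edges_reverse, List.mem_reverse, Sym2.eq_swap]; exact hab
      refine first_edge (pth_isPath hT u a).reverse hab' ?_
      rw [Walk.edges_reverse, List.mem_reverse, Sym2.eq_swap]
      exact Walk.mk_penultimate_end_mem_edges hnil
    · have h1 := pth_uniq hT ((pth_isPath hT u a).concat hbs hb)
      have h2 := hmax b (by rw [← h1]; simp [Walk.edges_concat, ha])
      rw [← h1, Walk.length_concat] at h2
      omega
  · rintro rfl
    exact (Walk.adj_penultimate hnil).symm

/-- Distinct edges are separated by some leaf-to-leaf path. -/
theorem leaf_sep [Fintype V] {G : SimpleGraph V} (hT : G.IsTree)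
    (hdeg : ∀ v : V, G.degree v ≠ 2) {e f : Sym2 V} (he : e ∈ G.edgeSet) (hf : f ∈ G.edgeSet)
    (hef : e ≠ f) : ∃ a b, G.degree a = 1 ∧ G.degree b = 1 ∧ ¬ RR G e a b ∧ RR G f a b := by
  have main : ∀ u y : V, G.Adj u y → s(u, y) ≠ f → (∀ q ∈ f, RR G s(u, y) u q) →
      ∃ a b, G.degree a = 1 ∧ G.degree b = 1 ∧ ¬ RR G s(u, y) a b ∧ RR G f a b := by
    intro u y huy _ hq
    obtain ⟨q, hqf, hqo⟩ := orient hT hf u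
    have hnil : ¬ (pth hT u q).Nil := by
      intro hn
      have h1 := (hqo q).2 (Walk.end_mem_support _)
      rw [Walk.edges_eq_nil.2 hn] at h1
      simp at h1
    set m := (pth hT u q).snd with hm
    have hme : s(u, m) ∈ (pth hT u q).edges := Walk.mk_start_snd_mem_edges hnil
    have hmadj : G.Adj u m := Walk.adj_snd hnil
    have hmy : m ≠ y := by
      intro h
      rw [h, on_iff hT] at hme
      exact hme (hq q hqf)
    have hfm : ∀ a, f ∈ (pth hT u a).edges → s(u, m) ∈ (pth hT u a).edges := by
      intro a ha
      exact subpath_edge hT (pth_isPath hT u a) (Walk.start_mem_support _) ((hqo a).1 ha) hme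
    have ht : ∃ t, G.Adj u t ∧ t ≠ m ∧ t ≠ y := by
      by_contra hcon
      push Not at hcon
      apply hdeg u
      rw [← card_neighborFinset_eq_degree, Finset.card_eq_two]
      refine ⟨m, y, hmy, ?_⟩
      ext t
      simp only [mem_neighborFinset, Finset.mem_insert, Finset.mem_singleton]
      constructor
      · intro h
        by_cases h' : t = m
        · exact Or.inl h'
        · exact Or.inr (hcon t h h')
      · rintro (rfl | rfl)
        · exact hmadj
        · exact huy
    obtain ⟨t, hut, htm, hty⟩ := ht
    obtain ⟨a, ha, hae⟩ := exists_leaf hT huy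
    obtain ⟨b, hb, hbe⟩ := exists_leaf hT hut
    have h1 : RR G s(u, y) u b := by
      by_contra h
      rw [← on_iff hT] at h
      exact hty (first_edge (pth_isPath hT u b) hbe h)
    have h2 : RR G f u a := by
      by_contra h
      rw [← on_iff hT] at h
      exact hmy (first_edge (pth_isPath hT u a) (hfm a h) hae)
    have h3 : RR G f u b := by
      by_contra h
      rw [← on_iff hT] at h
      exact htm (first_edge (pth_isPath hT u b) (hfm b h) hbe).symm
    rw [on_iff hT] at hae
    exact ⟨a, b, ha, hb, fun h => hae (h1.trans h.symm), h2.symm.trans h3⟩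
  induction e with | _ x y =>
  induction f with | _ z w =>
  have hxy : G.Adj x y := he
  have hzw : RR G s(x, y) z w := by
    refine Adj.reachable ?_
    rw [deleteEdges_adj]
    exact ⟨hf, fun h => hef h.symm⟩
  rcases RR_two hT hxy z with h | h
  · apply main x y hxy hef
    intro q hq
    rcases Sym2.mem_iff.1 hq with rfl | rfl
    · exact h.symm
    · exact h.symm.trans hzw
  · rw [Sym2.eq_swap] at h hef hzw ⊢
    apply main y x hxy.symm hef
    intro q hq
    rcases Sym2.mem_iff.1 hq with rfl | rfl
    · exact h.symm
    · exact h.symm.trans hzw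

theorem leaf_cut [Fintype V] {G : SimpleGraph V} (hT : G.IsTree)
    {e : Sym2 V} (he : e ∈ G.edgeSet) :
    ∃ a b, G.degree a = 1 ∧ G.degree b = 1 ∧ ¬ RR G e a b := by
  induction e with | _ x y =>
  have hxy : G.Adj x y := he
  obtain ⟨a, ha, hae⟩ := exists_leaf hT hxy
  obtain ⟨b, hb, hbe⟩ := exists_leaf hT hxy.symm
  refine ⟨a, b, ha, hb, ?_⟩
  rw [Sym2.eq_swap] at hbe
  rw [on_iff hT] at hae hbe
  intro h
  rcases RR_two hT hxy a with h1 | h1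
  · exact hae h1.symm
  · exact hbe (h1.symm.trans h)

theorem cons_le_aux {α : Type*} [LinearOrder α] {x c : α} {l m : List α}
    (h : x :: l ≤ c :: m) : x < c ∨ (x = c ∧ l ≤ m) := by
  rcases le_iff_lt_or_eq.1 h with h | h
  · cases h with
    | cons h => exact Or.inr ⟨rfl, le_of_lt h⟩
    | rel h => exact Or.inl h
  · rw [List.cons.injEq] at h
    exact Or.inr ⟨h.1, h.2.le⟩

theorem prefix_lex {α : Type*} [LinearOrder α] (L A B C : List α) (hA : L <+: A) (hB : L <+: B)
    (h1 : A ≤ C) (h2 : C ≤ B) : L <+: C := by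
  induction L generalizing A B C with
  | nil => simp
  | cons x L ih =>
    obtain ⟨A', rfl⟩ := hA
    obtain ⟨B', rfl⟩ := hB
    cases C with
    | nil =>
      rcases le_iff_lt_or_eq.1 h1 with h | h
      · nomatch h
      · nomatch h
    | cons c C =>
      replace h1 := cons_le_aux h1
      replace h2 := cons_le_aux h2
      have hxc : x = c := by
        rcases h1 with h1 | h1 <;> rcases h2 with h2 | h2
        · exact absurd (h1.trans h2) (lt_irrefl _)
        · exact h2.1.symm
        · exact h1.1
        · exact h1.1
      subst hxc
      rw [List.cons_prefix_cons]
      refine ⟨rfl, ih (L ++ A') (L ++ B') C (List.prefix_append _ _) (List.prefix_append _ _) ?_ ?_⟩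
      · simpa using h1
      · simpa using h2

/-- The cyclic boundary of a nontrivial interval has exactly two elements. -/
theorem boundary_card {n : ℕ} (S : Fin (n + 1) → Prop)
    (hconv : ∀ i j k, i ≤ j → j ≤ k → S i → S k → S j) (h1 : ∃ i, S i) (h0 : ∃ i, ¬ S i) :
    (Finset.univ.filter (fun i => ¬ (S i ↔ S (i + 1)))).card = 2 := by
  obtain ⟨i1, h1⟩ := h1
  obtain ⟨i0, h0⟩ := h0
  have hne : (Finset.univ.filter S).Nonempty := ⟨i1, by simpa using h1⟩
  obtain ⟨s, hs, hsmin⟩ := Finset.exists_min_image _ id hne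
  obtain ⟨t, ht, htmax⟩ := Finset.exists_max_image _ id hne
  simp only [Finset.mem_filter, Finset.mem_univ, true_and, id] at hs hsmin ht htmax
  have hS : ∀ i, S i ↔ s.val ≤ i.val ∧ i.val ≤ t.val := fun i =>
    ⟨fun h => ⟨hsmin i h, htmax i h⟩, fun h => hconv s i t h.1 h.2 hs ht⟩
  have hst : s.val ≤ t.val := ((hS s).1 hs).2
  have hi0 := (not_congr (hS i0)).1 h0
  have hsub : (s - 1) + 1 = s := by simp
  have hval : ∀ i : Fin (n + 1), (i.val = n ∧ (i + 1).val = 0) ∨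
      (i.val < n ∧ (i + 1).val = i.val + 1) := by
    intro i
    rw [Fin.val_add_one]
    split_ifs with h
    · left; simp [h]
    · right
      have : i.val ≠ n := fun h' => h (Fin.ext h')
      omega
  have hi0lt := i0.isLt
  have htlt := t.isLt
  rw [Finset.card_eq_two]
  refine ⟨s - 1, t, ?_, ?_⟩
  · intro h
    have := hval (s - 1)
    rw [hsub, h] at this
    omega
  · ext i
    simp only [Finset.mem_filter, Finset.mem_univ, true_and, Finset.mem_insert,
      Finset.mem_singleton]
    rw [eq_sub_iff_add_eq, Fin.ext_iff, Fin.ext_iff, hS, hS]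
    have := hval i
    have := hval t
    omega

end Helpers

section Order

/-- A planar ordering of the leaves: every edge has a cyclic boundary of size two. -/
theorem exists_order [Fintype V] {G : SimpleGraph V} (hT : G.IsTree) (n : ℕ)
    (hn : leafCount G = n + 1) :
    ∃ l : Fin (n + 1) → V, Function.Injective l ∧ (∀ a, G.degree a = 1 ↔ ∃ i, l i = a) ∧
      ∀ e ∈ G.edgeSet,
        (Finset.univ.filter (fun i => e ∈ (pth hT (l i) (l (i + 1))).edges)).card = 2 := by
  obtain ⟨r⟩ := hT.connected.nonempty
  let key : V → List (Fin (Fintype.card V)) := fun a =>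
    (pth hT r a).support.map (Fintype.equivFin V)
  have hpre : ∀ y a, y ∈ (pth hT r a).support ↔ key y <+: key a := by
    intro y a
    constructor
    · intro h
      have h1 := pth_uniq hT ((pth_isPath hT r a).takeUntil h)
      have h2 := Walk.support_takeUntil_prefix_support _ h
      rw [h1] at h2
      exact h2.map _
    · intro h
      have h1 : Fintype.equivFin V y ∈ key a :=
        h.subset (List.mem_map_of_mem (Walk.end_mem_support _))
      obtain ⟨z, hz, hzy⟩ := List.mem_map.1 h1
      rwa [← (Fintype.equivFin V).injective hzy]
  have hinj : Function.Injective key := by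
    intro a b hab
    have h1 : (pth hT r a).support = (pth hT r b).support :=
      List.map_injective_iff.2 (Fintype.equivFin V).injective hab
    have h2 := Walk.getLast_support (pth hT r a)
    have h3 := Walk.getLast_support (pth hT r b)
    rw [← h2, ← h3]
    congr 1
  letI : LinearOrder V := LinearOrder.lift' key hinj
  have hle : ∀ a b : V, a ≤ b → key a ≤ key b := fun a b h => h
  let L : Finset V := Finset.univ.filter (fun a => G.degree a = 1)
  have hL : L.card = n + 1 := by
    rw [← hn, leafCount, Nat.card_eq_fintype_card, Fintype.card_subtype]
    rfl
  let l := L.orderEmbOfFin hL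
  have hleaf : ∀ a, G.degree a = 1 ↔ ∃ i, l i = a := by
    intro a
    have h1 : a ∈ Set.range l ↔ a ∈ L := by
      rw [Finset.range_orderEmbOfFin]; simp
    rw [← Set.mem_range, h1]
    simp [L]
  refine ⟨l, l.injective, hleaf, ?_⟩
  intro e he
  obtain ⟨y, -, hy⟩ := orient hT he r
  have hS : ∀ a, ¬ RR G e r a ↔ key y <+: key a := by
    intro a
    rw [← on_iff hT, hy, hpre]
  obtain ⟨a, b, ha, hb, hab⟩ := leaf_cut hT he
  obtain ⟨i, rfl⟩ := (hleaf a).1 ha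
  obtain ⟨j, rfl⟩ := (hleaf b).1 hb
  rw [RR_xor hT he r] at hab
  have := boundary_card (fun i => ¬ RR G e r (l i)) ?_ ?_ ?_
  · rw [← this]
    congr 1
    ext i
    simp only [Finset.mem_filter, Finset.mem_univ, true_and]
    rw [on_iff hT, RR_xor hT he r]
    tauto
  · intro i j k hij hjk h1 h2
    simp only [hS] at h1 h2 ⊢
    exact prefix_lex _ _ _ _ h1 h2 (hle _ _ (l.monotone hij)) (hle _ _ (l.monotone hjk))
  · by_contra hcon
    push Not at hcon
    have := hcon i
    have := hcon j
    tauto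
  · by_contra hcon
    push Not at hcon
    have := hcon i
    have := hcon j
    tauto

theorem eq_of_boundary [Fintype V] {G : SimpleGraph V} (hT : G.IsTree)
    (hdeg : ∀ v : V, G.degree v ≠ 2) {n : ℕ} {l : Fin (n + 1) → V}
    (hleaf : ∀ a, G.degree a = 1 ↔ ∃ i, l i = a)
    {e f : Sym2 V} (he : e ∈ G.edgeSet) (hf : f ∈ G.edgeSet)
    (h : ∀ i, e ∈ (pth hT (l i) (l (i + 1))).edges ↔ f ∈ (pth hT (l i) (l (i + 1))).edges) :
    e = f := by
  by_contra hef
  obtain ⟨a, b, ha, hb, h1, h2⟩ := leaf_sep hT hdeg he hf hef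
  obtain ⟨i, rfl⟩ := (hleaf a).1 ha
  obtain ⟨j, rfl⟩ := (hleaf b).1 hb
  have key : ∀ i, RR G e (l 0) (l i) ↔ RR G f (l 0) (l i) := by
    intro i
    induction i using Fin.induction with
    | zero => exact iff_of_true (RR.refl _ _) (RR.refl _ _)
    | succ i ih =>
      have := h i.castSucc
      rw [on_iff hT, on_iff hT, RR_xor hT he (l 0), RR_xor hT hf (l 0),
        Fin.coeSucc_eq_succ] at this
      tauto
  rw [RR_xor hT he (l 0)] at h1
  rw [RR_xor hT hf (l 0)] at h2
  have := key i
  have := key j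
  tauto

end Order

theorem stmt12 [Fintype V] (G : SimpleGraph V) (hT : G.IsTree)
    (hdeg : ∀ v : V, G.degree v ≠ 2) (hleaves : 3 ≤ leafCount G) :
    ∃ F : Set (PathIn G), F.Finite ∧ F.ncard = leafCount G ∧
      EdgeSep G F ∧ EdgeCover G F ∧
      Separates G ((Sum.inl '' Set.univ) ∪ (Sum.inr '' interiorEdgeSet G)) F ∧
      Covers G ((Sum.inl '' Set.univ) ∪ (Sum.inr '' interiorEdgeSet G)) F := by
  obtain ⟨n, hn⟩ : ∃ n, leafCount G = n + 1 := ⟨leafCount G - 1, by omega⟩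
  obtain ⟨l, hinj, hleaf, hcard⟩ := exists_order hT n hn
  let P : Fin (n + 1) → PathIn G := fun i => ⟨l i, l (i + 1), pth hT _ _, pth_isPath hT _ _⟩
  have hPinj : Function.Injective P := fun i j hij => hinj (congrArg Sigma.fst hij)
  have hPp : ∀ i, (P i).2.2.1.IsPath := fun i => (P i).2.2.2
  -- containment of boundaries forces equality of edges
  have hsub : ∀ e ∈ G.edgeSet, ∀ f ∈ G.edgeSet,
      (∀ i, PathIn.emem e (P i) → PathIn.emem f (P i)) → e = f := by
    intro e he f hf h
    apply eq_of_boundary hT hdeg hleaf he hf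
    have h1 : (Finset.univ.filter (fun i => e ∈ (pth hT (l i) (l (i + 1))).edges)) =
        (Finset.univ.filter (fun i => f ∈ (pth hT (l i) (l (i + 1))).edges)) := by
      apply Finset.eq_of_subset_of_card_le
      · intro i hi
        simp only [Finset.mem_filter, Finset.mem_univ, true_and] at hi ⊢
        exact h i hi
      · rw [hcard e he, hcard f hf]
    intro i
    have := Finset.ext_iff.1 h1 i
    simpa using this
  have hEC : ∀ e ∈ G.edgeSet, ∃ i, PathIn.emem e (P i) := by
    intro e he
    have h1 : (Finset.univ.filter
        (fun i => e ∈ (pth hT (l i) (l (i + 1))).edges)).Nonempty := by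
      rw [← Finset.card_pos, hcard e he]; norm_num
    obtain ⟨i, hi⟩ := h1
    exact ⟨i, (Finset.mem_filter.1 hi).2⟩
  have hleaf3 : ∀ u v : V, ∃ w, G.degree w = 1 ∧ w ≠ u ∧ w ≠ v := by
    intro u v
    by_contra hcon
    push Not at hcon
    have h1 : (Finset.univ.image l) ⊆ {u, v} := by
      intro w hw
      obtain ⟨i, -, hi⟩ := Finset.mem_image.1 hw
      have := hcon w ((hleaf w).2 ⟨i, hi⟩)
      simp only [Finset.mem_insert, Finset.mem_singleton]
      tauto
    have h2 := Finset.card_le_card h1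
    rw [Finset.card_image_of_injective _ hinj, Finset.card_univ, Fintype.card_fin] at h2
    have := Finset.card_le_two (a := u) (b := v)
    omega
  have hne : ∀ u : V, ∃ w, G.Adj u w := by
    intro u
    obtain ⟨w, -, hw, -⟩ := hleaf3 u u
    have : ¬ (pth hT u w).Nil := fun h => hw h.eq.symm
    exact ⟨_, Walk.adj_snd this⟩
  have hvm : ∀ u w i, PathIn.emem s(u, w) (P i) → PathIn.vmem u (P i) := fun u w i h =>
    Walk.fst_mem_support_of_mem_edges _ h
  -- a vertex dominated by an edge is a leaf of that edge
  have hve : ∀ (u : V) (g : Sym2 V), g ∈ G.edgeSet →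
      (∀ i w, G.Adj u w → PathIn.emem s(u, w) (P i) → PathIn.emem g (P i)) →
      ∀ w, G.Adj u w → s(u, w) = g := by
    intro u g hg h w huw
    exact hsub _ huw _ hg fun i hi => h i w huw hi
  have hdeg1 : ∀ (u : V) (g : Sym2 V), (∀ w, G.Adj u w → s(u, w) = g) → G.degree u = 1 := by
    intro u g h
    obtain ⟨w, hw⟩ := hne u
    rw [← card_neighborFinset_eq_degree, Finset.card_eq_one]
    refine ⟨w, ?_⟩
    ext t
    simp only [mem_neighborFinset, Finset.mem_singleton]
    constructor
    · intro ht
      exact Sym2.congr_right.1 ((h t ht).trans (h w hw).symm)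
    · rintro rfl; exact hw
  have hEV : ∀ (u : V) (g : Sym2 V), g ∈ interiorEdgeSet G →
      ¬ ∀ i, (PathIn.vmem u (P i) ↔ PathIn.emem g (P i)) := by
    intro u g hg h
    have h1 := hve u g hg.1 fun i w _ hi => (h i).1 (hvm u w i hi)
    obtain ⟨w, hw⟩ := hne u
    exact hg.2 u (by rw [← h1 w hw]; simp) (hdeg1 u g h1)
  have hVV : ∀ u v : V, u ≠ v → ¬ ∀ i, (PathIn.vmem u (P i) ↔ PathIn.vmem v (P i)) := by
    have key : ∀ u v : V, u ≠ v → (∀ i, (PathIn.vmem u (P i) ↔ PathIn.vmem v (P i))) →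
        ∃ m, G.Adj u m ∧ (∀ w, G.Adj u w → s(u, w) = s(u, m)) ∧
        ∀ i, PathIn.vmem u (P i) → PathIn.emem s(u, m) (P i) := by
      intro u v huv h
      have hnil : ¬ (pth hT u v).Nil := fun h => huv h.eq
      have hm : ∀ i, PathIn.vmem u (P i) → PathIn.emem s(u, (pth hT u v).snd) (P i) := by
        intro i hi
        exact subpath_edge hT (hPp i) hi ((h i).1 hi) (Walk.mk_start_snd_mem_edges hnil)
      refine ⟨(pth hT u v).snd, Walk.adj_snd hnil, ?_, hm⟩
      exact hve u _ (Walk.adj_snd hnil) fun i w _ hi => hm i (hvm u w i hi)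
    intro u v huv h
    obtain ⟨m, hum, hm1, hm2⟩ := key u v huv h
    obtain ⟨m', hvm', hm1', hm2'⟩ := key v u huv.symm fun i => (h i).symm
    have h1 : s(u, m) = s(v, m') := hsub _ hum _ hvm' fun i hi =>
      hm2' i ((h i).1 (hvm u m i hi))
    have h2 : m = v ∧ m' = u := by
      rw [Sym2.eq_iff] at h1
      rcases h1 with h1 | h1
      · exact absurd h1.1 huv
      · exact ⟨h1.2, h1.1.symm⟩
    obtain ⟨rfl, rfl⟩ := h2
    obtain ⟨w, -, hwu, hwv⟩ := hleaf3 m' m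
    obtain ⟨d, -, hd1, hd2⟩ := (pth hT m' w).exists_boundary_dart {m', m} (by simp)
      (by simp [hwu, hwv])
    have hadj := d.adj
    simp only [Set.mem_insert_iff, Set.mem_singleton_iff] at hd1 hd2
    rcases hd1 with hd1 | hd1
    · rw [hd1] at hadj
      exact hd2 (Or.inr (Sym2.congr_right.1 (hm1 _ hadj)))
    · rw [hd1] at hadj
      exact hd2 (Or.inl (Sym2.congr_right.1 (hm1' _ hadj)))
  have hEE : ∀ e ∈ G.edgeSet, ∀ f ∈ G.edgeSet, e ≠ f →
      ¬ ∀ i, (PathIn.emem e (P i) ↔ PathIn.emem f (P i)) := fun e he f hf hef h =>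
    hef (hsub e he f hf fun i => (h i).1)
  have conv : ∀ A B : PathIn G → Prop, (¬ ∀ i, (A (P i) ↔ B (P i))) →
      ∃ Q ∈ Set.range P, (A Q ∧ ¬ B Q) ∨ (¬ A Q ∧ B Q) := by
    intro A B h
    rw [not_forall] at h
    obtain ⟨i, hi⟩ := h
    exact ⟨P i, ⟨i, rfl⟩, by tauto⟩
  refine ⟨Set.range P, Set.finite_range P, ?_, ?_, ?_, ?_, ?_⟩
  · rw [hn, ← Set.image_univ, Set.ncard_image_of_injective _ hPinj, Set.ncard_univ]
    simp
  · intro e he f hf hef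
    exact conv _ _ (hEE e he f hf hef)
  · intro e he
    obtain ⟨i, hi⟩ := hEC e he
    exact ⟨P i, ⟨i, rfl⟩, hi⟩
  · intro s hs t ht hst
    apply conv (ElemMem G s) (ElemMem G t)
    rcases hs with ⟨x, -, rfl⟩ | ⟨e, he, rfl⟩ <;> rcases ht with ⟨y, -, rfl⟩ | ⟨f, hf, rfl⟩
    · exact hVV x y fun h => hst (by rw [h])
    · exact hEV x f hf
    · exact fun h => hEV y e he fun i => (h i).symm
    · exact hEE e he.1 f hf.1 fun h => hst (by rw [h])
  · rintro s (⟨x, -, rfl⟩ | ⟨e, he, rfl⟩)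
    · obtain ⟨w, hw⟩ := hne x
      obtain ⟨i, hi⟩ := hEC s(x, w) hw
      exact ⟨P i, ⟨i, rfl⟩, hvm x w i hi⟩
    · obtain ⟨i, hi⟩ := hEC e he.1
      exact ⟨P i, ⟨i, rfl⟩, hi⟩
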